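/- Let N ≥ 1, 0 < γ < min{2,N}, p > p_F := 1 + 2/N, 0 < T < ∞ and z ∈ ℝ^N \ {0}. There exist constants c* > 0 and C* > 0 depending only on N, p, γ (and not on T or z) with the following property: if u₀ is a nonnegative measurable function on ℝ^N satisfying u₀(x) ≤ c |z|^{γ/(p−1)} |x−z|^{−2/(p−1)} + C₀ for all x ∈ ℝ^N \ {z}, where 0 < c ≤ c* and 0 ≤ C₀ ≤ C* T^{−(2−γ)/(2(p−1))}, then the Hardy parabolic equation ∂_t u − Δu = |x|^{−γ} u^p with initial data u₀ possesses a solution on ℝ^N × [0,T). -/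

import Mathlib

open MeasureTheory Real Set

noncomputable def heatKernel (N : ℕ) (x : EuclideanSpace ℝ (Fin N)) (t : ℝ) : ℝ :=
  (4 * Real.pi * t) ^ (-(N : ℝ) / 2) * Real.exp (-‖x‖ ^ 2 / (4 * t))

/-- `u` is a (nonnegative, integral) solution of `∂_t u - Δu = |x|^{-γ} u^p`
with initial data the nonnegative measurable function `u₀`, on `ℝ^N × [0,T)`. -/
def IsSol (N : ℕ) (γ p T : ℝ) (u₀ : EuclideanSpace ℝ (Fin N) → ℝ)
    (u : EuclideanSpace ℝ (Fin N) → ℝ → ℝ) : Prop :=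
  Measurable (Function.uncurry u) ∧ (∀ x t, 0 ≤ u x t) ∧
    ∀ᵐ q : EuclideanSpace ℝ (Fin N) × ℝ,
      q.2 ∈ Set.Ioo 0 T →
        u q.1 q.2 = (∫ y, heatKernel N (q.1 - y) q.2 * u₀ y) +
          ∫ s in Set.Ioo 0 q.2, ∫ y,
            heatKernel N (q.1 - y) (q.2 - s) * ‖y‖ ^ (-γ) * u y s ^ p

open scoped ENNReal

section HeatKernel

variable {N : ℕ}

lemma heatKernel_nonneg (x : EuclideanSpace ℝ (Fin N)) {t : ℝ} (ht : 0 ≤ t) :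
    0 ≤ heatKernel N x t := by
  unfold heatKernel; positivity

lemma measurable_heatKernel_uncurry :
    Measurable fun q : EuclideanSpace ℝ (Fin N) × ℝ => heatKernel N q.1 q.2 := by
  unfold heatKernel
  fun_prop

lemma lintegral_heatKernel (x : EuclideanSpace ℝ (Fin N)) {t : ℝ} (ht : 0 < t) :
    ∫⁻ y, ENNReal.ofReal (heatKernel N (x - y) t) = 1 := by
  rw [lintegral_sub_left_eq_self (fun y => ENNReal.ofReal (heatKernel N y t)) x]
  have hb : 0 < 1 / (4 * t) := by positivity
  have key := GaussianFourier.integral_rexp_neg_mul_sq_norm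
    (V := EuclideanSpace ℝ (Fin N)) hb
  have h1 : ∫ y, heatKernel N y t = 1 := by
    have : ∀ y : EuclideanSpace ℝ (Fin N), heatKernel N y t =
        (4 * Real.pi * t) ^ (-(N : ℝ) / 2) * Real.exp (-(1 / (4 * t)) * ‖y‖ ^ 2) := by
      intro y
      unfold heatKernel
      congr 2
      ring
    simp_rw [this]
    rw [integral_const_mul, key, finrank_euclideanSpace_fin]
    have e : Real.pi / (1 / (4 * t)) = 4 * Real.pi * t := by field_simp
    rw [e, ← Real.rpow_add (by positivity)]
    ring_nf
    simp
  have hint : Integrable fun y : EuclideanSpace ℝ (Fin N) => heatKernel N y t := by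
    by_contra h
    rw [integral_undef h] at h1
    exact zero_ne_one h1
  rw [← ofReal_integral_eq_lintegral_ofReal hint
    (Filter.Eventually.of_forall fun y => heatKernel_nonneg y ht.le), h1, ENNReal.ofReal_one]

lemma heatKernel_le_rpow_time (x : EuclideanSpace ℝ (Fin N)) {t : ℝ} (ht : 0 < t) :
    heatKernel N x t ≤ t ^ (-(N : ℝ) / 2) := by
  unfold heatKernel
  have h1 : Real.exp (-‖x‖ ^ 2 / (4 * t)) ≤ 1 := by
    rw [Real.exp_le_one_iff]
    exact div_nonpos_of_nonpos_of_nonneg (by simp) (by positivity)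
  have h2 : (4 * Real.pi * t) ^ (-(N : ℝ) / 2) ≤ t ^ (-(N : ℝ) / 2) := by
    apply Real.rpow_le_rpow_of_nonpos ht
    · nlinarith [Real.pi_gt_three]
    · have : (0 : ℝ) ≤ N := by positivity
      linarith
  calc _ ≤ (4 * Real.pi * t) ^ (-(N : ℝ) / 2) * 1 := by gcongr
    _ ≤ _ := by simpa using h2

lemma rpow_le_rpow_mul_exp {m q : ℝ} (hm : 0 < m) (hq : 0 ≤ q) :
    q ^ m ≤ m ^ m * Real.exp q := by
  have h1 : q ≤ m * Real.exp (q / m) := by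
    have := Real.add_one_le_exp (q / m)
    have h2 : q = m * (q / m) := by field_simp
    calc q = m * (q / m) := h2
      _ ≤ _ := by gcongr; linarith
  calc q ^ m ≤ (m * Real.exp (q / m)) ^ m := by gcongr
    _ = m ^ m * Real.exp q := by
      rw [Real.mul_rpow hm.le (Real.exp_pos _).le, ← Real.exp_mul]
      congr 2
      field_simp

lemma heatKernel_le_rpow_norm (hN : 1 ≤ N) {x : EuclideanSpace ℝ (Fin N)} (hx : x ≠ 0) {t : ℝ}
    (ht : 0 < t) :
    heatKernel N x t ≤ ((N : ℝ) / 2) ^ ((N : ℝ) / 2) * ‖x‖ ^ (-(N : ℝ)) := by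
  have hN' : (0 : ℝ) < N := by exact_mod_cast hN
  have hx' : 0 < ‖x‖ := norm_pos_iff.2 hx
  set q := ‖x‖ ^ 2 / (4 * t) with hq
  have hq0 : 0 < q := by positivity
  have h1 := rpow_le_rpow_mul_exp (m := (N : ℝ) / 2) (by positivity) hq0.le
  have h2 : (4 * Real.pi * t) ^ (-(N : ℝ) / 2) ≤ (4 * t) ^ (-(N : ℝ) / 2) := by
    apply Real.rpow_le_rpow_of_nonpos (by positivity)
    · nlinarith [Real.pi_gt_three]
    · linarith
  have h3 : (4 * t) ^ (-(N : ℝ) / 2) = q ^ ((N : ℝ) / 2) * ‖x‖ ^ (-(N : ℝ)) := by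
    rw [hq, Real.div_rpow (by positivity) (by positivity), ← Real.rpow_natCast,
      ← Real.rpow_mul hx'.le, neg_div, Real.rpow_neg (by positivity), Real.rpow_neg hx'.le]
    have : ((2 : ℕ) : ℝ) * ((N : ℝ) / 2) = N := by push_cast; ring
    rw [this]
    have := Real.rpow_pos_of_pos hx' N
    field_simp
  unfold heatKernel
  have h4 : -‖x‖ ^ 2 / (4 * t) = -q := by rw [hq]; ring
  rw [h4]
  calc _ ≤ q ^ ((N : ℝ) / 2) * ‖x‖ ^ (-(N : ℝ)) * Real.exp (-q) := by
        rw [← h3]; gcongr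
    _ ≤ (((N : ℝ) / 2) ^ ((N : ℝ) / 2) * Real.exp q) * ‖x‖ ^ (-(N : ℝ)) * Real.exp (-q) := by
        gcongr
    _ = _ := by
        rw [Real.exp_neg]
        have := Real.exp_pos q
        field_simp

/-- On a ball of radius comparable to `√t` or to the distance from `x`, the heat kernel is at most
a constant times the inverse volume of the ball. -/
lemma exists_heatKernel_le (hN : 1 ≤ N) : ∃ C : ℝ, 0 < C ∧
    ∀ (x : EuclideanSpace ℝ (Fin N)) (t r : ℝ), 0 < t → 0 < r → (r ^ 2 ≤ t ∨ r ≤ ‖x‖) →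
      heatKernel N x t ≤ C * r ^ (-(N : ℝ)) := by
  have hN' : (0 : ℝ) < N := by exact_mod_cast hN
  refine ⟨1 + ((N : ℝ) / 2) ^ ((N : ℝ) / 2), by positivity, ?_⟩
  intro x t r ht hr h
  have hr' : 0 ≤ r ^ (-(N : ℝ)) := by positivity
  have hc : 0 ≤ ((N : ℝ) / 2) ^ ((N : ℝ) / 2) := by positivity
  rcases h with h | h
  · calc _ ≤ t ^ (-(N : ℝ) / 2) := heatKernel_le_rpow_time x ht
      _ ≤ (r ^ 2) ^ (-(N : ℝ) / 2) :=
        Real.rpow_le_rpow_of_nonpos (by positivity) h (by linarith)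
      _ = r ^ (-(N : ℝ)) := by
        rw [← Real.rpow_natCast, ← Real.rpow_mul hr.le]
        congr 1; push_cast; ring
      _ ≤ _ := by nlinarith
  · have hx : x ≠ 0 := norm_pos_iff.1 (hr.trans_le h)
    calc _ ≤ _ := heatKernel_le_rpow_norm hN hx ht
      _ ≤ ((N : ℝ) / 2) ^ ((N : ℝ) / 2) * r ^ (-(N : ℝ)) := by
        gcongr ?_ * ?_
        exact Real.rpow_le_rpow_of_nonpos hr h (by linarith)
      _ ≤ _ := by nlinarith

lemma exists_lintegral_ball_rpow_le (hN : 1 ≤ N) {b : ℝ} (hb : b < N) : ∃ C : ℝ, 0 < C ∧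
    ∀ (z : EuclideanSpace ℝ (Fin N)) (r : ℝ), 0 < r →
      ∫⁻ y in Metric.ball z r, ENNReal.ofReal (‖y - z‖ ^ (-b)) ≤
        ENNReal.ofReal (C * r ^ ((N : ℝ) - b)) := by
  have hint : ∀ r : ℝ, IntegrableOn (fun y : EuclideanSpace ℝ (Fin N) => ‖y‖ ^ (-b))
      (Metric.ball 0 r) := fun r => by
    refine integrableOn_ball_of_norm_le_rpow (C := 1) (α := b) (by simpa using hN)
      (by simpa using hb) ?_ ?_
    · refine Filter.Eventually.of_forall fun x => ?_
      rw [Real.norm_of_nonneg (by positivity), one_mul]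
    · exact Measurable.aestronglyMeasurable (by fun_prop)
  set I := ∫ y in Metric.ball (0 : EuclideanSpace ℝ (Fin N)) 1, ‖y‖ ^ (-b) with hI
  have hI0 : 0 ≤ I := integral_nonneg fun y => by positivity
  refine ⟨I + 1, by positivity, fun z r hr => ?_⟩
  have h1 : ∫⁻ y in Metric.ball z r, ENNReal.ofReal (‖y - z‖ ^ (-b)) =
      ∫⁻ y in Metric.ball (0 : EuclideanSpace ℝ (Fin N)) r, ENNReal.ofReal (‖y‖ ^ (-b)) := by
    rw [← lintegral_indicator measurableSet_ball, ← lintegral_indicator measurableSet_ball,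
      ← lintegral_sub_right_eq_self ((Metric.ball (0 : EuclideanSpace ℝ (Fin N)) r).indicator
        fun y => ENNReal.ofReal (‖y‖ ^ (-b))) z]
    refine lintegral_congr fun y => ?_
    by_cases hy : y ∈ Metric.ball z r
    · have hy' : y - z ∈ Metric.ball (0 : EuclideanSpace ℝ (Fin N)) r := by
        rwa [mem_ball_zero_iff, ← mem_ball_iff_norm]
      simp only [Set.indicator_of_mem hy, Set.indicator_of_mem hy']
    · have hy' : y - z ∉ Metric.ball (0 : EuclideanSpace ℝ (Fin N)) r := by
        rwa [mem_ball_zero_iff, ← mem_ball_iff_norm]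
      simp only [Set.indicator_of_notMem hy, Set.indicator_of_notMem hy']
  rw [h1, ← ofReal_integral_eq_lintegral_ofReal (hint r)
    (Filter.Eventually.of_forall fun y => by positivity)]
  apply ENNReal.ofReal_le_ofReal
  have h2 := Measure.setIntegral_comp_smul_of_pos (volume : Measure (EuclideanSpace ℝ (Fin N)))
    (fun y => ‖y‖ ^ (-b)) (Metric.ball 0 1) hr
  rw [smul_unitBall_of_pos hr] at h2
  have h3 : ∫ y in Metric.ball (0 : EuclideanSpace ℝ (Fin N)) 1, ‖r • y‖ ^ (-b) =
      r ^ (-b) * I := by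
    rw [hI, ← integral_const_mul]
    refine integral_congr_ae (Filter.Eventually.of_forall fun y => ?_)
    simp only [norm_smul, Real.norm_of_nonneg hr.le]
    rw [Real.mul_rpow hr.le (norm_nonneg _)]
  rw [h3, finrank_euclideanSpace_fin, smul_eq_mul] at h2
  have hrN : (0 : ℝ) < r ^ N := by positivity
  have h4 : ∫ y in Metric.ball (0 : EuclideanSpace ℝ (Fin N)) r, ‖y‖ ^ (-b) =
      r ^ ((N : ℝ) - b) * I := by
    rw [sub_eq_add_neg, Real.rpow_add hr, Real.rpow_natCast, mul_assoc, h2]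
    field_simp
  rw [h4]
  have : 0 ≤ r ^ ((N : ℝ) - b) := by positivity
  nlinarith

end HeatKernel

section HeatAverage

variable {N : ℕ}

/-- The value at `x` of the heat semigroup at time `t` applied to the positive part of `f`. -/
noncomputable def heatAvg (t : ℝ) (f : EuclideanSpace ℝ (Fin N) → ℝ)
    (x : EuclideanSpace ℝ (Fin N)) : ℝ≥0∞ :=
  ∫⁻ y, ENNReal.ofReal (heatKernel N (x - y) t * f y)

lemma heatAvg_mono_ae {t : ℝ} (ht : 0 ≤ t) {f g : EuclideanSpace ℝ (Fin N) → ℝ}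
    (h : ∀ᵐ y, f y ≤ g y) (x : EuclideanSpace ℝ (Fin N)) : heatAvg t f x ≤ heatAvg t g x := by
  refine lintegral_mono_ae ?_
  filter_upwards [h] with y hy
  exact ENNReal.ofReal_le_ofReal (mul_le_mul_of_nonneg_left hy (heatKernel_nonneg _ ht))

lemma heatAvg_mono_ne (hN : 1 ≤ N) {t : ℝ} (ht : 0 ≤ t) {f g : EuclideanSpace ℝ (Fin N) → ℝ}
    (z : EuclideanSpace ℝ (Fin N)) (h : ∀ y, y ≠ z → f y ≤ g y)
    (x : EuclideanSpace ℝ (Fin N)) : heatAvg t f x ≤ heatAvg t g x := by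
  have : Nonempty (Fin N) := ⟨⟨0, hN⟩⟩
  refine heatAvg_mono_ae ht ?_ x
  filter_upwards [compl_mem_ae_iff.2 (measure_singleton (μ := volume) z)] with y hy
  exact h y hy

lemma heatAvg_const_mul {c : ℝ} (hc : 0 ≤ c) (t : ℝ) (f : EuclideanSpace ℝ (Fin N) → ℝ)
    (x : EuclideanSpace ℝ (Fin N)) :
    heatAvg t (fun y => c * f y) x = ENNReal.ofReal c * heatAvg t f x := by
  unfold heatAvg
  rw [← lintegral_const_mul' _ _ ENNReal.ofReal_ne_top]
  refine lintegral_congr fun y => ?_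
  rw [← ENNReal.ofReal_mul hc]
  congr 1; ring

lemma heatAvg_const {c : ℝ} (hc : 0 ≤ c) {t : ℝ} (ht : 0 < t) (x : EuclideanSpace ℝ (Fin N)) :
    heatAvg t (fun _ => c) x = ENNReal.ofReal c := by
  have := heatAvg_const_mul hc t (fun _ => 1) x
  simp only [mul_one] at this
  rw [this]
  unfold heatAvg
  simp only [mul_one]
  rw [lintegral_heatKernel x ht, mul_one]

lemma heatAvg_add_le {t : ℝ} {f g : EuclideanSpace ℝ (Fin N) → ℝ} (hf : Measurable f)
    (x : EuclideanSpace ℝ (Fin N)) :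
    heatAvg t (fun y => f y + g y) x ≤ heatAvg t f x + heatAvg t g x := by
  unfold heatAvg
  rw [← lintegral_add_left]
  · refine lintegral_mono fun y => ?_
    rw [mul_add]
    exact ENNReal.ofReal_add_le
  · refine ENNReal.measurable_ofReal.comp (Measurable.mul ?_ hf)
    exact measurable_heatKernel_uncurry.comp
      (by fun_prop : Measurable fun y : EuclideanSpace ℝ (Fin N) => (x - y, t))

lemma exists_heatAvg_rpow_le (hN : 1 ≤ N) {b : ℝ} (hb0 : 0 ≤ b) (hb : b < N) :
    ∃ C : ℝ, 0 < C ∧ ∀ (x z : EuclideanSpace ℝ (Fin N)) (t r : ℝ), 0 < t → 0 < r →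
      (r ^ 2 ≤ t ∨ 2 * r ≤ ‖x - z‖) →
        heatAvg t (fun y => ‖y - z‖ ^ (-b)) x ≤ ENNReal.ofReal (C * r ^ (-b)) := by
  obtain ⟨C1, hC1, h1⟩ := exists_heatKernel_le hN
  obtain ⟨C2, hC2, h2⟩ := exists_lintegral_ball_rpow_le hN hb
  refine ⟨C1 * C2 + 1, by positivity, fun x z t r ht hr h => ?_⟩
  unfold heatAvg
  rw [← lintegral_add_compl _ (measurableSet_ball (x := z) (ε := r))]
  have hrb : 0 ≤ r ^ (-b) := by positivity
  have hin : ∫⁻ y in Metric.ball z r, ENNReal.ofReal (heatKernel N (x - y) t * ‖y - z‖ ^ (-b)) ≤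
      ENNReal.ofReal (C1 * C2 * r ^ (-b)) := by
    calc _ ≤ ∫⁻ y in Metric.ball z r,
          ENNReal.ofReal (C1 * r ^ (-(N : ℝ))) * ENNReal.ofReal (‖y - z‖ ^ (-b)) := by
          refine setLIntegral_mono' measurableSet_ball fun y hy => ?_
          rw [← ENNReal.ofReal_mul (by positivity)]
          refine ENNReal.ofReal_le_ofReal (mul_le_mul_of_nonneg_right ?_ (by positivity))
          refine h1 _ _ _ ht hr (h.imp_right fun h => ?_)
          rw [mem_ball_iff_norm] at hy
          have h3 : ‖x - z‖ ≤ ‖x - y‖ + ‖y - z‖ := norm_sub_le_norm_sub_add_norm_sub _ _ _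
          linarith
      _ ≤ ENNReal.ofReal (C1 * r ^ (-(N : ℝ))) * ENNReal.ofReal (C2 * r ^ ((N : ℝ) - b)) := by
          rw [lintegral_const_mul' _ _ ENNReal.ofReal_ne_top]
          gcongr
          exact h2 z r hr
      _ = _ := by
          rw [← ENNReal.ofReal_mul (by positivity)]
          congr 1
          have : r ^ (-b) = r ^ (-(N : ℝ)) * r ^ ((N : ℝ) - b) := by
            rw [← Real.rpow_add hr]; congr 1; ring
          rw [this]; ring
  have hout : ∫⁻ y in (Metric.ball z r)ᶜ,
      ENNReal.ofReal (heatKernel N (x - y) t * ‖y - z‖ ^ (-b)) ≤ ENNReal.ofReal (r ^ (-b)) := by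
    calc _ ≤ ∫⁻ y in (Metric.ball z r)ᶜ, ENNReal.ofReal (heatKernel N (x - y) t * r ^ (-b)) := by
          refine setLIntegral_mono' measurableSet_ball.compl fun y hy => ?_
          refine ENNReal.ofReal_le_ofReal
            (mul_le_mul_of_nonneg_left ?_ (heatKernel_nonneg _ ht.le))
          rw [Set.mem_compl_iff, mem_ball_iff_norm, not_lt] at hy
          exact Real.rpow_le_rpow_of_nonpos hr hy (by linarith)
      _ ≤ heatAvg t (fun _ => r ^ (-b)) x := setLIntegral_le_lintegral _ _
      _ = _ := heatAvg_const hrb ht x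
  calc _ ≤ ENNReal.ofReal (C1 * C2 * r ^ (-b)) + ENNReal.ofReal (r ^ (-b)) := add_le_add hin hout
    _ = _ := by
      rw [← ENNReal.ofReal_add (by positivity) hrb]
      congr 1; ring

lemma exists_heatAvg_rpow_le_time (hN : 1 ≤ N) {b : ℝ} (hb0 : 0 ≤ b) (hb : b < N) :
    ∃ C : ℝ, 0 < C ∧ ∀ (x z : EuclideanSpace ℝ (Fin N)) (t : ℝ), 0 < t →
        heatAvg t (fun y => ‖y - z‖ ^ (-b)) x ≤ ENNReal.ofReal (C * t ^ (-b / 2)) := by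
  obtain ⟨C, hC, h⟩ := exists_heatAvg_rpow_le hN hb0 hb
  refine ⟨C, hC, fun x z t ht => ?_⟩
  convert h x z t (√t) ht (Real.sqrt_pos.2 ht) (Or.inl (Real.sq_sqrt ht.le).le) using 3
  rw [Real.sqrt_eq_rpow, ← Real.rpow_mul ht.le]
  congr 1; ring

lemma sq_sqrt_div_four_trichotomy {X t s : ℝ} (hX : 0 ≤ X) (ht : 0 < t) (hs : 0 ≤ s) :
    (√(X ^ 2 + s + t) / 4) ^ 2 ≤ t ∨ 2 * (√(X ^ 2 + s + t) / 4) ≤ X ∨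
      (√(X ^ 2 + s + t) / 4) ^ 2 ≤ s := by
  have hQ : 0 ≤ X ^ 2 + s + t := by positivity
  have h1 := Real.sq_sqrt hQ
  have h0 := Real.sqrt_nonneg (X ^ 2 + s + t)
  by_contra! h
  obtain ⟨ha, hb, hc⟩ := h
  nlinarith

lemma sqrt_div_four_rpow {Q b : ℝ} (hQ : 0 ≤ Q) :
    (√Q / 4) ^ (-b) = 4 ^ b * Q ^ (-b / 2) := by
  rw [Real.div_rpow (Real.sqrt_nonneg _) (by norm_num), Real.sqrt_eq_rpow, ← Real.rpow_mul hQ,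
    Real.rpow_neg (by norm_num : (0 : ℝ) ≤ 4), div_inv_eq_mul, mul_comm]
  congr 2; ring

lemma norm_sq_add_rpow_le {y : EuclideanSpace ℝ (Fin N)} (hy : y ≠ 0) {s b : ℝ} (hs : 0 ≤ s)
    (hb : 0 ≤ b) : (‖y‖ ^ 2 + s) ^ (-b / 2) ≤ ‖y‖ ^ (-b) := by
  have hy' : 0 < ‖y‖ := norm_pos_iff.2 hy
  calc _ ≤ (‖y‖ ^ 2) ^ (-b / 2) :=
        Real.rpow_le_rpow_of_nonpos (by positivity) (by linarith) (by linarith)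
    _ = _ := by
      rw [← Real.rpow_natCast, ← Real.rpow_mul hy'.le]
      congr 1; push_cast; ring

/-- The heat semigroup maps `(|y - z|² + s)^(-b/2)` to a function bounded by a constant times
`(|x - z|² + s + t)^(-b/2)`, provided `0 ≤ b < N`. -/
lemma exists_heatAvg_profile_le (hN : 1 ≤ N) {b : ℝ} (hb0 : 0 ≤ b) (hb : b < N) :
    ∃ C : ℝ, 0 < C ∧ ∀ (x z : EuclideanSpace ℝ (Fin N)) (t s : ℝ), 0 < t → 0 ≤ s →
      heatAvg t (fun y => (‖y - z‖ ^ 2 + s) ^ (-b / 2)) x ≤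
        ENNReal.ofReal (C * (‖x - z‖ ^ 2 + s + t) ^ (-b / 2)) := by
  obtain ⟨C, hC, h⟩ := exists_heatAvg_rpow_le hN hb0 hb
  refine ⟨(C + 1) * 4 ^ b, by positivity, fun x z t s ht hs => ?_⟩
  set Q := ‖x - z‖ ^ 2 + s + t with hQ
  have hQ0 : 0 < Q := by positivity
  have hr0 : 0 < √Q / 4 := by positivity
  have hr := sqrt_div_four_rpow (b := b) hQ0.le
  have hcases := sq_sqrt_div_four_trichotomy (norm_nonneg (x - z)) ht hs
  rw [← hQ, ← or_assoc] at hcases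
  rw [mul_assoc, ← hr]
  have hrb : 0 ≤ (√Q / 4) ^ (-b) := by positivity
  rcases hcases with hc | hc
  · calc _ ≤ heatAvg t (fun y => ‖y - z‖ ^ (-b)) x := by
          refine heatAvg_mono_ne hN ht.le z (fun y hy => ?_) x
          exact norm_sq_add_rpow_le (sub_ne_zero.2 hy) hs hb0
      _ ≤ _ := h x z t _ ht hr0 hc
      _ ≤ _ := ENNReal.ofReal_le_ofReal (by nlinarith)
  · have hrb' : (√Q / 4) ^ (-b) = ((√Q / 4) ^ 2) ^ (-b / 2) := by
      rw [← Real.rpow_natCast, ← Real.rpow_mul hr0.le]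
      congr 1; push_cast; ring
    calc _ ≤ heatAvg t (fun _ => (√Q / 4) ^ (-b)) x := by
          refine heatAvg_mono_ae ht.le (Filter.Eventually.of_forall fun y => ?_) x
          rw [hrb']
          refine Real.rpow_le_rpow_of_nonpos (by positivity) ?_ (by linarith)
          nlinarith [sq_nonneg ‖y - z‖]
      _ = _ := heatAvg_const hrb ht x
      _ ≤ _ := ENNReal.ofReal_le_ofReal (by nlinarith)

/-- Decay of the heat semigroup applied to the truncation of `|y|^(-γ)` to a ball of
radius `√ρ`. -/
lemma exists_heatAvg_truncated_le (hN : 1 ≤ N) {γ b : ℝ} (hγ : 0 ≤ γ) (hγb : γ ≤ b) (hb : b < N) :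
    ∃ C : ℝ, 0 < C ∧ ∀ (x : EuclideanSpace ℝ (Fin N)) (t ρ : ℝ), 0 < t → 0 < ρ →
      heatAvg t (fun y => if ‖y‖ ^ 2 < ρ then ‖y‖ ^ (-γ) else 0) x ≤
        ENNReal.ofReal (C * (ρ ^ (b / 2) * (t ^ (-γ / 2) + ρ ^ (-γ / 2)) *
          (‖x‖ ^ 2 + ρ + t) ^ (-b / 2))) := by
  have hb0 : 0 ≤ b := hγ.trans hγb
  obtain ⟨C1, hC1, h1⟩ := exists_heatAvg_rpow_le hN hb0 hb
  obtain ⟨C2, hC2, h2⟩ := exists_heatAvg_rpow_le_time hN hγ (hγb.trans_lt hb)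
  refine ⟨(C1 + C2) * 4 ^ b, by positivity, fun x t ρ ht hρ => ?_⟩
  set Q := ‖x‖ ^ 2 + ρ + t with hQ
  have hQ0 : 0 < Q := by positivity
  have hr0 : 0 < √Q / 4 := by positivity
  have hr := sqrt_div_four_rpow (b := b) hQ0.le
  have hcases := sq_sqrt_div_four_trichotomy (norm_nonneg x) ht hρ.le
  rw [← hQ, ← or_assoc] at hcases
  have hρb : 0 < ρ ^ (b / 2) := by positivity
  have hρg : 0 < ρ ^ (-γ / 2) := by positivity
  have htg : 0 < t ^ (-γ / 2) := by positivity
  have e : (C1 + C2) * 4 ^ b * (ρ ^ (b / 2) * (t ^ (-γ / 2) + ρ ^ (-γ / 2)) * Q ^ (-b / 2)) =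
      (C1 + C2) * (ρ ^ (b / 2) * (t ^ (-γ / 2) + ρ ^ (-γ / 2)) * (√Q / 4) ^ (-b)) := by
    rw [hr]; ring
  rw [e]
  have hrb : 0 < (√Q / 4) ^ (-b) := by positivity
  rcases hcases with hc | hc
  · calc _ ≤ heatAvg t (fun y => ρ ^ ((b - γ) / 2) * ‖y - 0‖ ^ (-b)) x := by
          refine heatAvg_mono_ne hN ht.le 0 (fun y hy => ?_) x
          have hy' : 0 < ‖y‖ := norm_pos_iff.2 hy
          rw [sub_zero]
          split_ifs with hlt
          · have : ‖y‖ ^ (-γ) = ‖y‖ ^ (b - γ) * ‖y‖ ^ (-b) := by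
              rw [← Real.rpow_add hy']; congr 1; ring
            rw [this]
            gcongr
            calc ‖y‖ ^ (b - γ) = (‖y‖ ^ 2) ^ ((b - γ) / 2) := by
                  rw [← Real.rpow_natCast, ← Real.rpow_mul hy'.le]
                  congr 1; push_cast; ring
              _ ≤ _ := Real.rpow_le_rpow (by positivity) hlt.le (by linarith)
          · positivity
      _ ≤ ENNReal.ofReal (ρ ^ ((b - γ) / 2)) * ENNReal.ofReal (C1 * (√Q / 4) ^ (-b)) := by
          rw [heatAvg_const_mul (by positivity)]
          gcongr
          exact h1 x 0 t _ ht hr0 (by simpa using hc)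
      _ ≤ _ := by
          rw [← ENNReal.ofReal_mul (by positivity)]
          apply ENNReal.ofReal_le_ofReal
          have : ρ ^ ((b - γ) / 2) = ρ ^ (b / 2) * ρ ^ (-γ / 2) := by
            rw [← Real.rpow_add hρ]; congr 1; ring
          rw [this]
          have h3 : 0 ≤ C2 * (ρ ^ (b / 2) * (t ^ (-γ / 2) + ρ ^ (-γ / 2)) * (√Q / 4) ^ (-b)) := by
            positivity
          have h4 : 0 ≤ C1 * (ρ ^ (b / 2) * t ^ (-γ / 2) * (√Q / 4) ^ (-b)) := by
            positivity
          linarith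
  · have hone : 1 ≤ ρ ^ (b / 2) * (√Q / 4) ^ (-b) := by
      have : (√Q / 4) ^ (-b) = ((√Q / 4) ^ 2) ^ (-b / 2) := by
        rw [← Real.rpow_natCast, ← Real.rpow_mul hr0.le]
        congr 1; push_cast; ring
      rw [this]
      calc 1 = ρ ^ (b / 2) * ρ ^ (-b / 2) := by
            rw [← Real.rpow_add hρ, neg_div, add_neg_cancel, Real.rpow_zero]
        _ ≤ _ := by
            gcongr ?_ * ?_
            exact Real.rpow_le_rpow_of_nonpos (by positivity) hc (by linarith)
    calc _ ≤ heatAvg t (fun y => ‖y - 0‖ ^ (-γ)) x := by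
          refine heatAvg_mono_ae ht.le (Filter.Eventually.of_forall fun y => ?_) x
          rw [sub_zero]
          split_ifs
          · exact le_rfl
          · positivity
      _ ≤ _ := h2 x 0 t ht
      _ ≤ _ := by
          apply ENNReal.ofReal_le_ofReal
          calc C2 * t ^ (-γ / 2) ≤ (C1 + C2) * (t ^ (-γ / 2) + ρ ^ (-γ / 2)) := by
                gcongr <;> linarith
            _ ≤ (C1 + C2) * (t ^ (-γ / 2) + ρ ^ (-γ / 2)) * (ρ ^ (b / 2) * (√Q / 4) ^ (-b)) :=
                le_mul_of_one_le_right (by positivity) hone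
            _ = _ := by ring

lemma lintegral_Ioo_rpow {κ t : ℝ} (hκ : 0 < κ) (ht : 0 < t) :
    ∫⁻ s in Set.Ioo 0 t, ENNReal.ofReal (s ^ (κ - 1)) = ENNReal.ofReal (t ^ κ / κ) := by
  have hint : IntegrableOn (fun s : ℝ => s ^ (κ - 1)) (Set.Ioo 0 t) := by
    rw [intervalIntegral.integrableOn_Ioo_rpow_iff ht]; linarith
  rw [← ofReal_integral_eq_lintegral_ofReal hint]
  · rw [← integral_Ioc_eq_integral_Ioo, ← intervalIntegral.integral_of_le ht.le,
      integral_rpow (Or.inl (by linarith)), sub_add_cancel, Real.zero_rpow hκ.ne', sub_zero]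
  · filter_upwards [ae_restrict_mem measurableSet_Ioo] with s hs
    exact Real.rpow_nonneg hs.1.le _

lemma lintegral_Ioo_sub_rpow {σ t : ℝ} (hσ : σ < 1) (ht : 0 < t) :
    ∫⁻ s in Set.Ioo 0 t, ENNReal.ofReal ((t - s) ^ (-σ)) =
      ENNReal.ofReal (t ^ (1 - σ) / (1 - σ)) := by
  rw [← lintegral_Ioo_rpow (sub_pos.2 hσ) ht, ← lintegral_indicator measurableSet_Ioo,
    ← lintegral_indicator measurableSet_Ioo,
    ← lintegral_sub_left_eq_self ((Set.Ioo 0 t).indicator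
      fun s : ℝ => ENNReal.ofReal (s ^ (1 - σ - 1))) t]
  refine lintegral_congr fun s => ?_
  have e : 1 - σ - 1 = -σ := by ring
  by_cases hs : s ∈ Set.Ioo 0 t
  · have hs' : t - s ∈ Set.Ioo 0 t := ⟨by linarith [hs.2], by linarith [hs.1]⟩
    rw [Set.indicator_of_mem hs, Set.indicator_of_mem hs', e]
  · have hs' : t - s ∉ Set.Ioo 0 t := fun h => hs ⟨by linarith [h.2], by linarith [h.1]⟩
    rw [Set.indicator_of_notMem hs, Set.indicator_of_notMem hs']

end HeatAverage

section Duhamel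

variable {N : ℕ}

lemma exists_duhamel_const_le (hN : 1 ≤ N) {γ : ℝ} (hγ0 : 0 ≤ γ) (hγ2 : γ < 2) (hγN : γ < N) :
    ∃ C : ℝ, 0 < C ∧ ∀ (x : EuclideanSpace ℝ (Fin N)) (t : ℝ), 0 < t →
      ∫⁻ s in Set.Ioo 0 t, heatAvg (t - s) (fun y => ‖y‖ ^ (-γ)) x ≤
        ENNReal.ofReal (C * t ^ (1 - γ / 2)) := by
  obtain ⟨C, hC, h⟩ := exists_heatAvg_rpow_le_time hN hγ0 hγN
  have hσ : 0 < 1 - γ / 2 := by linarith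
  refine ⟨C / (1 - γ / 2), by positivity, fun x t ht => ?_⟩
  calc _ ≤ ∫⁻ s in Set.Ioo 0 t, ENNReal.ofReal C * ENNReal.ofReal ((t - s) ^ (-(γ / 2))) := by
        refine setLIntegral_mono' measurableSet_Ioo fun s hs => ?_
        rw [← ENNReal.ofReal_mul hC.le, ← neg_div]
        simpa using h x 0 (t - s) (sub_pos.2 hs.2)
    _ = _ := by
        rw [lintegral_const_mul' _ _ ENNReal.ofReal_ne_top,
          lintegral_Ioo_sub_rpow (by linarith) ht, ← ENNReal.ofReal_mul hC.le]
        congr 1; ring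

lemma rpow_weight_le {R s t κ δ γ : ℝ} (hR : 0 < R) (hs : 0 < s) (hst : s < t) (hδ1 : δ ≤ 1)
    (hδκ : δ ≤ κ) (hκ : 0 ≤ κ) (hγ : 0 ≤ γ) :
    (R + s) ^ (κ - 1) * ((t - s) ^ (-γ / 2) + (R + s) ^ (-γ / 2)) ≤
      2 * R ^ (-γ / 2) * (R + t) ^ (κ - δ) * s ^ (δ - 1) +
        2 * (R + t) ^ (κ - 1) * (t - s) ^ (-γ / 2) := by
  have hρ : 0 < R + s := by positivity
  have hτ : 0 < t - s := sub_pos.2 hst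
  have hRt : 0 < R + t := by linarith
  have h1 : (R + s) ^ (κ - 1) ≤ (R + t) ^ (κ - δ) * s ^ (δ - 1) := by
    calc (R + s) ^ (κ - 1) = (R + s) ^ (κ - δ) * (R + s) ^ (δ - 1) := by
          rw [← Real.rpow_add hρ]; congr 1; ring
      _ ≤ _ := by
          gcongr ?_ * ?_
          · exact Real.rpow_le_rpow hρ.le (by linarith) (by linarith)
          · exact Real.rpow_le_rpow_of_nonpos hs (by linarith) (by linarith)
  have h2 : (R + s) ^ (-γ / 2) ≤ R ^ (-γ / 2) :=
    Real.rpow_le_rpow_of_nonpos hR (by linarith) (by linarith)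
  have h3 : (R + s) ^ (κ - 1) * (t - s) ^ (-γ / 2) ≤
      (R + t) ^ (κ - δ) * s ^ (δ - 1) * R ^ (-γ / 2) +
        2 * (R + t) ^ (κ - 1) * (t - s) ^ (-γ / 2) := by
    rcases le_or_gt R (t - s) with h | h
    · have : (t - s) ^ (-γ / 2) ≤ R ^ (-γ / 2) :=
        Real.rpow_le_rpow_of_nonpos hR h (by linarith)
      have h4 : 0 ≤ 2 * (R + t) ^ (κ - 1) * (t - s) ^ (-γ / 2) := by positivity
      calc _ ≤ (R + t) ^ (κ - δ) * s ^ (δ - 1) * R ^ (-γ / 2) := by gcongr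
        _ ≤ _ := by linarith
    · have h5 : (R + s) ^ (κ - 1) ≤ 2 * (R + t) ^ (κ - 1) := by
        rw [Real.rpow_sub hρ, Real.rpow_sub hRt, Real.rpow_one, Real.rpow_one, ← mul_div_assoc,
          div_le_div_iff₀ hρ hRt]
        have h6 : (R + s) ^ κ ≤ (R + t) ^ κ := Real.rpow_le_rpow hρ.le (by linarith) hκ
        calc _ ≤ (R + t) ^ κ * (2 * (R + s)) := by gcongr; linarith
          _ = _ := by ring
      have h4 : 0 ≤ (R + t) ^ (κ - δ) * s ^ (δ - 1) * R ^ (-γ / 2) := by positivity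
      calc _ ≤ 2 * (R + t) ^ (κ - 1) * (t - s) ^ (-γ / 2) := by gcongr
        _ ≤ _ := by linarith
  have h7 : (R + s) ^ (κ - 1) * (R + s) ^ (-γ / 2) ≤
      (R + t) ^ (κ - δ) * s ^ (δ - 1) * R ^ (-γ / 2) := by gcongr
  calc _ = (R + s) ^ (κ - 1) * (t - s) ^ (-γ / 2) + (R + s) ^ (κ - 1) * (R + s) ^ (-γ / 2) := by
        ring
    _ ≤ _ := by linarith

lemma source_le {γ a δ s : ℝ} (hγ : 0 ≤ γ) (ha : 0 ≤ a) (hδ : δ ≤ 1) (hs : 0 < s)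
    {y z : EuclideanSpace ℝ (Fin N)} (hz : z ≠ 0) :
    ‖y‖ ^ (-γ) * (‖y - z‖ ^ 2 + s) ^ (-(a + 2) / 2) ≤
      2 ^ γ * ‖z‖ ^ (-γ) * s ^ (δ - 1) * (‖y - z‖ ^ 2 + s) ^ (-(a + 2 * δ) / 2) +
        4 ^ ((a + 2) / 2) * (‖z‖ ^ 2 + s) ^ (-(a + 2) / 2) *
          (if ‖y‖ ^ 2 < ‖z‖ ^ 2 + s then ‖y‖ ^ (-γ) else 0) := by
  have hz' : 0 < ‖z‖ := norm_pos_iff.2 hz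
  have hq : 0 < ‖y - z‖ ^ 2 + s := by positivity
  rcases le_or_gt (‖z‖ / 2) ‖y‖ with h | h
  · have h1 : ‖y‖ ^ (-γ) ≤ 2 ^ γ * ‖z‖ ^ (-γ) := by
      calc _ ≤ (‖z‖ / 2) ^ (-γ) :=
            Real.rpow_le_rpow_of_nonpos (by positivity) h (by linarith)
        _ = _ := by
            rw [Real.div_rpow hz'.le (by norm_num), Real.rpow_neg (by norm_num : (0 : ℝ) ≤ 2),
              div_inv_eq_mul, mul_comm]
    have h2 : (‖y - z‖ ^ 2 + s) ^ (-(a + 2) / 2) ≤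
        s ^ (δ - 1) * (‖y - z‖ ^ 2 + s) ^ (-(a + 2 * δ) / 2) := by
      calc _ = (‖y - z‖ ^ 2 + s) ^ (δ - 1) * (‖y - z‖ ^ 2 + s) ^ (-(a + 2 * δ) / 2) := by
            rw [← Real.rpow_add hq]; congr 1; ring
        _ ≤ _ := by
            gcongr ?_ * _
            exact Real.rpow_le_rpow_of_nonpos hs (by nlinarith [sq_nonneg ‖y - z‖]) (by linarith)
    have h3 : 0 ≤ 4 ^ ((a + 2) / 2) * (‖z‖ ^ 2 + s) ^ (-(a + 2) / 2) *
          (if ‖y‖ ^ 2 < ‖z‖ ^ 2 + s then ‖y‖ ^ (-γ) else 0) := by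
      split_ifs <;> positivity
    calc _ ≤ 2 ^ γ * ‖z‖ ^ (-γ) * (s ^ (δ - 1) * (‖y - z‖ ^ 2 + s) ^ (-(a + 2 * δ) / 2)) := by
          gcongr
      _ ≤ _ := by rw [← mul_assoc]; linarith
  · have hlt : ‖y‖ ^ 2 < ‖z‖ ^ 2 + s := by nlinarith [norm_nonneg y]
    rw [if_pos hlt]
    have h1 : ‖z‖ / 2 ≤ ‖y - z‖ := by
      have := norm_sub_norm_le z y
      rw [norm_sub_rev] at this
      linarith
    have h2 : (‖y - z‖ ^ 2 + s) ^ (-(a + 2) / 2) ≤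
        4 ^ ((a + 2) / 2) * (‖z‖ ^ 2 + s) ^ (-(a + 2) / 2) := by
      calc _ ≤ ((‖z‖ ^ 2 + s) / 4) ^ (-(a + 2) / 2) := by
            refine Real.rpow_le_rpow_of_nonpos (by positivity) ?_ (by linarith)
            nlinarith
        _ = _ := by
            rw [Real.div_rpow (by positivity) (by norm_num), neg_div,
              Real.rpow_neg (by norm_num : (0 : ℝ) ≤ 4), div_inv_eq_mul, mul_comm]
    have h3 : 0 ≤ 2 ^ γ * ‖z‖ ^ (-γ) * s ^ (δ - 1) *
        (‖y - z‖ ^ 2 + s) ^ (-(a + 2 * δ) / 2) := by positivity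
    calc _ ≤ ‖y‖ ^ (-γ) * (4 ^ ((a + 2) / 2) * (‖z‖ ^ 2 + s) ^ (-(a + 2) / 2)) := by gcongr
      _ ≤ _ := by linarith

lemma profile_comparison {a b κ t : ℝ} (ha : 0 ≤ a) (hκ : 0 ≤ κ) (hab : κ - b / 2 = -a / 2)
    (ht : 0 < t) (x z : EuclideanSpace ℝ (Fin N)) :
    (‖z‖ ^ 2 + t) ^ κ * (‖x‖ ^ 2 + ‖z‖ ^ 2 + t) ^ (-b / 2) ≤
      2 ^ (a / 2) * (‖x - z‖ ^ 2 + t) ^ (-a / 2) := by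
  have hY : 0 < ‖x‖ ^ 2 + ‖z‖ ^ 2 + t := by positivity
  calc _ ≤ (‖x‖ ^ 2 + ‖z‖ ^ 2 + t) ^ κ * (‖x‖ ^ 2 + ‖z‖ ^ 2 + t) ^ (-b / 2) := by
        gcongr
        nlinarith [sq_nonneg ‖x‖]
    _ = (‖x‖ ^ 2 + ‖z‖ ^ 2 + t) ^ (-a / 2) := by
        rw [← Real.rpow_add hY, ← hab]; congr 1; ring
    _ ≤ ((‖x - z‖ ^ 2 + t) / 2) ^ (-a / 2) := by
        refine Real.rpow_le_rpow_of_nonpos (by positivity) ?_ (by linarith)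
        have h1 := norm_sub_le x z
        have h2 : ‖x - z‖ ^ 2 ≤ (‖x‖ + ‖z‖) ^ 2 := by gcongr
        nlinarith [sq_nonneg (‖x‖ - ‖z‖)]
    _ = _ := by
        rw [Real.div_rpow (by positivity) (by norm_num), neg_div,
          Real.rpow_neg (by norm_num : (0 : ℝ) ≤ 2), div_inv_eq_mul, mul_comm]

lemma rpow_mul_rpow_neg_le {q t a δ : ℝ} (ht : 0 < t) (hq : 0 ≤ q) (hδ : 0 ≤ δ) :
    t ^ δ * (q + t) ^ (-(a + 2 * δ) / 2) ≤ (q + t) ^ (-a / 2) := by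
  have hqt : 0 < q + t := by positivity
  calc _ ≤ (q + t) ^ δ * (q + t) ^ (-(a + 2 * δ) / 2) := by
        gcongr; linarith
    _ = _ := by rw [← Real.rpow_add hqt]; congr 1; ring

/-- The Duhamel term generated by the singular profile centred at `z` is controlled by the profile
itself. -/
lemma exists_duhamel_profile_le (hN : 1 ≤ N) {γ a : ℝ} (hγ0 : 0 < γ) (hγ2 : γ < 2) (hγN : γ < N)
    (ha0 : 0 < a) (haN : a < N) :
    ∃ C : ℝ, 0 < C ∧ ∀ (x z : EuclideanSpace ℝ (Fin N)) (t : ℝ), z ≠ 0 → 0 < t →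
      ∫⁻ s in Set.Ioo 0 t,
          heatAvg (t - s) (fun y => ‖y‖ ^ (-γ) * (‖y - z‖ ^ 2 + s) ^ (-(a + 2) / 2)) x ≤
        ENNReal.ofReal (C * (‖z‖ ^ (-γ) * (‖x - z‖ ^ 2 + t) ^ (-a / 2))) := by
  obtain ⟨b, hb1, hbN⟩ := exists_between (max_lt haN hγN)
  have hab : a < b := (le_max_left _ _).trans_lt hb1
  have hγb : γ ≤ b := ((le_max_right _ _).trans_lt hb1).le
  set κ := (b - a) / 2 with hκ
  have hκ0 : 0 < κ := by rw [hκ]; linarith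
  set δ := min 1 κ with hδ
  have hδ0 : 0 < δ := lt_min one_pos hκ0
  have hδ1 : δ ≤ 1 := min_le_left _ _
  have hδκ : δ ≤ κ := min_le_right _ _
  have hσ : 0 < 1 - γ / 2 := by linarith
  obtain ⟨C1, hC1, h1⟩ := exists_heatAvg_profile_le hN (b := a + 2 * δ) (by positivity)
    (by linarith)
  obtain ⟨C2, hC2, h2⟩ := exists_heatAvg_truncated_le hN hγ0.le hγb hbN
  set D : ℝ := 4 ^ ((a + 2) / 2) with hD
  have hD0 : 0 < D := by positivity
  refine ⟨2 ^ γ * C1 / δ + (D * C2 * 2 / δ + D * C2 * 2 / (1 - γ / 2)) * 2 ^ (a / 2),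
    by positivity, fun x z t hz ht => ?_⟩
  have hz' : 0 < ‖z‖ := norm_pos_iff.2 hz
  set R := ‖z‖ ^ 2 with hR
  have hR0 : 0 < R := by positivity
  have hRγ : R ^ (-γ / 2) = ‖z‖ ^ (-γ) := by
    rw [hR, ← Real.rpow_natCast, ← Real.rpow_mul hz'.le]
    congr 1; push_cast; ring
  set X := ‖x - z‖ ^ 2 + t with hX
  set Y := ‖x‖ ^ 2 + R + t with hY
  have hX0 : 0 < X := by positivity
  have hY0 : 0 < Y := by positivity
  set K1 := 2 ^ γ * ‖z‖ ^ (-γ) * (C1 * X ^ (-(a + 2 * δ) / 2)) +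
    D * C2 * (2 * R ^ (-γ / 2) * (R + t) ^ (κ - δ)) * Y ^ (-b / 2) with hK1
  set K2 := D * C2 * (2 * (R + t) ^ (κ - 1)) * Y ^ (-b / 2) with hK2
  have hK10 : 0 ≤ K1 := by positivity
  have hK20 : 0 ≤ K2 := by positivity
  have hpt : ∀ s ∈ Set.Ioo 0 t,
      heatAvg (t - s) (fun y => ‖y‖ ^ (-γ) * (‖y - z‖ ^ 2 + s) ^ (-(a + 2) / 2)) x ≤
        ENNReal.ofReal K1 * ENNReal.ofReal (s ^ (δ - 1)) +
          ENNReal.ofReal K2 * ENNReal.ofReal ((t - s) ^ (-(γ / 2))) := by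
    rintro s ⟨hs, hst⟩
    have hτ : 0 < t - s := sub_pos.2 hst
    have hρ : 0 < R + s := by positivity
    calc _ ≤ heatAvg (t - s) (fun y =>
          2 ^ γ * ‖z‖ ^ (-γ) * s ^ (δ - 1) * (‖y - z‖ ^ 2 + s) ^ (-(a + 2 * δ) / 2) +
          D * (R + s) ^ (-(a + 2) / 2) *
            (if ‖y‖ ^ 2 < R + s then ‖y‖ ^ (-γ) else 0)) x :=
          heatAvg_mono_ae hτ.le (Filter.Eventually.of_forall fun y =>
            source_le hγ0.le ha0.le hδ1 hs hz) x
      _ ≤ _ := heatAvg_add_le (by fun_prop) x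
      _ ≤ ENNReal.ofReal (2 ^ γ * ‖z‖ ^ (-γ) * s ^ (δ - 1)) *
            ENNReal.ofReal (C1 * X ^ (-(a + 2 * δ) / 2)) +
          ENNReal.ofReal (D * (R + s) ^ (-(a + 2) / 2)) *
            ENNReal.ofReal (C2 * ((R + s) ^ (b / 2) *
              ((t - s) ^ (-γ / 2) + (R + s) ^ (-γ / 2)) * Y ^ (-b / 2))) := by
          rw [heatAvg_const_mul (by positivity), heatAvg_const_mul (by positivity)]
          gcongr
          · have e2 : ‖x - z‖ ^ 2 + s + (t - s) = X := by rw [hX]; ring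
            exact (h1 x z (t - s) s hτ hs.le).trans_eq (by rw [e2])
          · have e2 : ‖x‖ ^ 2 + (R + s) + (t - s) = Y := by rw [hY]; ring
            exact (h2 x (t - s) (R + s) hτ hρ).trans_eq (by rw [e2])
      _ ≤ _ := by
          rw [← ENNReal.ofReal_mul (by positivity), ← ENNReal.ofReal_mul (by positivity),
            ← ENNReal.ofReal_mul (by positivity), ← ENNReal.ofReal_mul (by positivity),
            ← ENNReal.ofReal_add (by positivity) (by positivity),
            ← ENNReal.ofReal_add (by positivity) (by positivity)]
          apply ENNReal.ofReal_le_ofReal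
          have hw := rpow_weight_le hR0 hs hst hδ1 hδκ hκ0.le hγ0.le
          have e1 : (R + s) ^ (-(a + 2) / 2) * (R + s) ^ (b / 2) = (R + s) ^ (κ - 1) := by
            rw [← Real.rpow_add hρ]; congr 1; rw [hκ]; ring
          have hw' := mul_le_mul_of_nonneg_left hw
            (by positivity : 0 ≤ D * C2 * Y ^ (-b / 2))
          rw [← e1] at hw'
          rw [hK1, hK2, ← neg_div]
          calc _ = 2 ^ γ * ‖z‖ ^ (-γ) * s ^ (δ - 1) * (C1 * X ^ (-(a + 2 * δ) / 2)) +
                D * C2 * Y ^ (-b / 2) * ((R + s) ^ (-(a + 2) / 2) * (R + s) ^ (b / 2) *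
                ((t - s) ^ (-γ / 2) + (R + s) ^ (-γ / 2))) := by ring
            _ ≤ _ := by
              refine (add_le_add_right hw' _).trans_eq ?_
              ring
  have hmeas : Measurable fun s : ℝ => ENNReal.ofReal K1 * ENNReal.ofReal (s ^ (δ - 1)) := by
    fun_prop
  calc _ ≤ ∫⁻ s in Set.Ioo 0 t, (ENNReal.ofReal K1 * ENNReal.ofReal (s ^ (δ - 1)) +
          ENNReal.ofReal K2 * ENNReal.ofReal ((t - s) ^ (-(γ / 2)))) :=
        setLIntegral_mono' measurableSet_Ioo hpt
    _ = ENNReal.ofReal (K1 * (t ^ δ / δ) + K2 * (t ^ (1 - γ / 2) / (1 - γ / 2))) := by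
        rw [lintegral_add_left hmeas, lintegral_const_mul' _ _ ENNReal.ofReal_ne_top,
          lintegral_const_mul' _ _ ENNReal.ofReal_ne_top, lintegral_Ioo_rpow hδ0 ht,
          lintegral_Ioo_sub_rpow (by linarith) ht, ← ENNReal.ofReal_mul hK10,
          ← ENNReal.ofReal_mul hK20, ← ENNReal.ofReal_add (by positivity) (by positivity)]
    _ ≤ _ := by
        apply ENNReal.ofReal_le_ofReal
        have hRt : 0 < R + t := by positivity
        have hc1 : t ^ δ * X ^ (-(a + 2 * δ) / 2) ≤ X ^ (-a / 2) :=
          rpow_mul_rpow_neg_le ht (by positivity) hδ0.le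
        have hc2 : (R + t) ^ κ * Y ^ (-b / 2) ≤ 2 ^ (a / 2) * X ^ (-a / 2) :=
          profile_comparison ha0.le hκ0.le (by rw [hκ]; ring) ht x z
        have hc3 : (R + t) ^ (κ - δ) * t ^ δ ≤ (R + t) ^ κ := by
          calc _ ≤ (R + t) ^ (κ - δ) * (R + t) ^ δ := by gcongr; linarith
            _ = _ := by rw [← Real.rpow_add hRt]; congr 1; ring
        have hc4 : (R + t) ^ (κ - 1) * t ^ (1 - γ / 2) ≤ R ^ (-γ / 2) * (R + t) ^ κ := by
          calc _ ≤ (R + t) ^ (κ - 1) * (R + t) ^ (1 - γ / 2) := by gcongr; linarith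
            _ = (R + t) ^ (-γ / 2) * (R + t) ^ κ := by
              rw [← Real.rpow_add hRt, ← Real.rpow_add hRt]; congr 1; ring
            _ ≤ _ := by
              gcongr ?_ * _
              exact Real.rpow_le_rpow_of_nonpos hR0 (by linarith) (by linarith)
        set P := X ^ (-a / 2)
        calc _ = 2 ^ γ * ‖z‖ ^ (-γ) * C1 / δ * (t ^ δ * X ^ (-(a + 2 * δ) / 2)) +
              D * C2 * 2 / δ * R ^ (-γ / 2) * ((R + t) ^ (κ - δ) * t ^ δ) * Y ^ (-b / 2) +
              D * C2 * 2 / (1 - γ / 2) * ((R + t) ^ (κ - 1) * t ^ (1 - γ / 2)) *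
                Y ^ (-b / 2) := by
              rw [hK1, hK2]; ring
          _ ≤ 2 ^ γ * ‖z‖ ^ (-γ) * C1 / δ * P +
              D * C2 * 2 / δ * R ^ (-γ / 2) * (R + t) ^ κ * Y ^ (-b / 2) +
              D * C2 * 2 / (1 - γ / 2) * (R ^ (-γ / 2) * (R + t) ^ κ) * Y ^ (-b / 2) := by
              gcongr
          _ = 2 ^ γ * ‖z‖ ^ (-γ) * C1 / δ * P +
              (D * C2 * 2 / δ + D * C2 * 2 / (1 - γ / 2)) * ‖z‖ ^ (-γ) *
                ((R + t) ^ κ * Y ^ (-b / 2)) := by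
              rw [hRγ]; ring
          _ ≤ 2 ^ γ * ‖z‖ ^ (-γ) * C1 / δ * P +
              (D * C2 * 2 / δ + D * C2 * 2 / (1 - γ / 2)) * ‖z‖ ^ (-γ) *
                (2 ^ (a / 2) * P) := by
              gcongr
          _ = _ := by ring

end Duhamel

section Existence

/-- Monotone iteration: an integral equation with a power nonlinearity and a nonnegative kernel
that has a supersolution `W` has a solution below `W`. -/
lemma exists_fixedPoint_le {X : Type*} [MeasurableSpace X] {μ : Measure X} [SFinite μ] {p : ℝ}
    (hp : 0 ≤ p) {h : X → ℝ≥0∞} (hh : Measurable h) {k : X → X → ℝ≥0∞}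
    (hk : Measurable (Function.uncurry k)) {W : X → ℝ≥0∞}
    (hW : ∀ q, h q + ∫⁻ r, k q r * W r ^ p ∂μ ≤ W q) :
    ∃ v : X → ℝ≥0∞, Measurable v ∧ (∀ q, v q ≤ W q) ∧
      ∀ q, v q = h q + ∫⁻ r, k q r * v r ^ p ∂μ := by
  let F : (X → ℝ≥0∞) → X → ℝ≥0∞ := fun v q => h q + ∫⁻ r, k q r * v r ^ p ∂μ
  have hF : Monotone F := fun v w hvw q => by
    refine add_le_add_right (lintegral_mono fun r => ?_) _
    exact mul_le_mul_right (ENNReal.rpow_le_rpow (hvw r) hp) _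
  have hFm : ∀ v, Measurable v → Measurable (F v) := fun v hv => by
    refine hh.add (Measurable.lintegral_prod_right' (f := fun q : X × X => k q.1 q.2 * v q.2 ^ p) ?_)
    exact hk.mul ((hv.comp measurable_snd).pow_const p)
  let V : ℕ → X → ℝ≥0∞ := fun n => F^[n] ⊥
  have hVs : ∀ n, V (n + 1) = F (V n) := fun n => Function.iterate_succ_apply' F n ⊥
  have hVm : ∀ n, Measurable (V n) := fun n => by
    induction n with
    | zero => exact measurable_const
    | succ n ih => rw [hVs]; exact hFm _ ih
  have hVW : ∀ n, V n ≤ W := fun n => by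
    induction n with
    | zero => exact bot_le
    | succ n ih => rw [hVs]; exact (hF ih).trans hW
  have hVmono : Monotone V := hF.monotone_iterate_of_le_map bot_le
  refine ⟨fun q => ⨆ n, V n q, Measurable.iSup hVm, fun q => iSup_le fun n => hVW n q,
    fun q => ?_⟩
  have hint : ∫⁻ r, k q r * (⨆ n, V n r) ^ p ∂μ = ⨆ n, ∫⁻ r, k q r * V n r ^ p ∂μ := by
    rw [← lintegral_iSup]
    · refine lintegral_congr fun r => ?_
      rw [← ENNReal.mul_iSup]
      congr 1
      rcases hp.eq_or_lt with rfl | hp'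
      · simp
      · exact (ENNReal.orderIsoRpow p hp').map_iSup _
    · exact fun n => (hk.comp measurable_prodMk_left).mul ((hVm n).pow_const p)
    · exact fun m n hmn r => mul_le_mul_right (ENNReal.rpow_le_rpow (hVmono hmn r) hp) _
  rw [hint, ENNReal.add_iSup]
  have : ∀ n, h q + ∫⁻ r, k q r * V n r ^ p ∂μ = V (n + 1) q := fun n => by rw [hVs]
  simp_rw [this]
  exact (Monotone.iSup_nat_add (f := fun n => V n q) (fun m n hmn => hVmono hmn q) 1).symm

variable {N : ℕ}

/-- The space-time kernel of the Duhamel term of the Hardy parabolic equation. -/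
noncomputable def duhamelKernel (γ : ℝ) (q r : EuclideanSpace ℝ (Fin N) × ℝ) : ℝ≥0∞ :=
  (Set.Ioo 0 q.2).indicator
    (fun s => ENNReal.ofReal (heatKernel N (q.1 - r.1) (q.2 - s) * ‖r.1‖ ^ (-γ))) r.2

lemma measurable_weighted_heatKernel (γ : ℝ) :
    Measurable fun P : (EuclideanSpace ℝ (Fin N) × ℝ) × EuclideanSpace ℝ (Fin N) × ℝ =>
      ENNReal.ofReal (heatKernel N (P.1.1 - P.2.1) (P.1.2 - P.2.2) * ‖P.2.1‖ ^ (-γ)) := by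
  refine ENNReal.measurable_ofReal.comp (Measurable.mul ?_ (by fun_prop))
  exact measurable_heatKernel_uncurry.comp
    (by fun_prop : Measurable fun P : (EuclideanSpace ℝ (Fin N) × ℝ) ×
      EuclideanSpace ℝ (Fin N) × ℝ => (P.1.1 - P.2.1, P.1.2 - P.2.2))

lemma measurable_duhamelKernel (γ : ℝ) :
    Measurable (Function.uncurry (duhamelKernel (N := N) γ)) := by
  have h1 : MeasurableSet {P : (EuclideanSpace ℝ (Fin N) × ℝ) × EuclideanSpace ℝ (Fin N) × ℝ |
      0 < P.2.2} := measurableSet_lt measurable_const (by fun_prop)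
  have h2 : MeasurableSet {P : (EuclideanSpace ℝ (Fin N) × ℝ) × EuclideanSpace ℝ (Fin N) × ℝ |
      P.2.2 < P.1.2} := measurableSet_lt (by fun_prop) (by fun_prop)
  exact (measurable_weighted_heatKernel γ).indicator (h1.inter h2)

lemma lintegral_duhamelKernel_mul (γ : ℝ) (q : EuclideanSpace ℝ (Fin N) × ℝ)
    {V : EuclideanSpace ℝ (Fin N) × ℝ → ℝ≥0∞} (hV : Measurable V) :
    ∫⁻ r, duhamelKernel γ q r * V r = ∫⁻ s in Set.Ioo 0 q.2, ∫⁻ y,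
      ENNReal.ofReal (heatKernel N (q.1 - y) (q.2 - s) * ‖y‖ ^ (-γ)) * V (y, s) := by
  have hm : Measurable fun r => duhamelKernel γ q r * V r :=
    ((measurable_duhamelKernel γ).comp measurable_prodMk_left).mul hV
  rw [Measure.volume_eq_prod, lintegral_prod_symm _ hm.aemeasurable,
    ← lintegral_indicator measurableSet_Ioo]
  refine lintegral_congr fun s => ?_
  unfold duhamelKernel
  by_cases hs : s ∈ Set.Ioo 0 q.2
  · simp only [Set.indicator_of_mem hs]
  · simp only [Set.indicator_of_notMem hs, zero_mul, lintegral_zero]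

lemma measurable_lintegral_slice (γ : ℝ) (q : EuclideanSpace ℝ (Fin N) × ℝ)
    {V : EuclideanSpace ℝ (Fin N) × ℝ → ℝ≥0∞} (hV : Measurable V) :
    Measurable fun s : ℝ => ∫⁻ y,
      ENNReal.ofReal (heatKernel N (q.1 - y) (q.2 - s) * ‖y‖ ^ (-γ)) * V (y, s) := by
  refine Measurable.lintegral_prod_left' (f := fun P : EuclideanSpace ℝ (Fin N) × ℝ =>
    ENNReal.ofReal (heatKernel N (q.1 - P.1) (q.2 - P.2) * ‖P.1‖ ^ (-γ)) * V P) ?_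
  refine Measurable.mul (ENNReal.measurable_ofReal.comp (Measurable.mul ?_ (by fun_prop))) hV
  exact measurable_heatKernel_uncurry.comp
    (by fun_prop : Measurable fun P : EuclideanSpace ℝ (Fin N) × ℝ => (q.1 - P.1, q.2 - P.2))

lemma measurable_heatAvg_uncurry {f : EuclideanSpace ℝ (Fin N) → ℝ} (hf : Measurable f) :
    Measurable fun q : EuclideanSpace ℝ (Fin N) × ℝ => heatAvg q.2 f q.1 := by
  refine Measurable.lintegral_prod_right'
    (f := fun P : (EuclideanSpace ℝ (Fin N) × ℝ) × EuclideanSpace ℝ (Fin N) =>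
      ENNReal.ofReal (heatKernel N (P.1.1 - P.2) P.1.2 * f P.2)) ?_
  refine ENNReal.measurable_ofReal.comp (Measurable.mul ?_ (by fun_prop))
  exact measurable_heatKernel_uncurry.comp
    (by fun_prop : Measurable fun P : (EuclideanSpace ℝ (Fin N) × ℝ) ×
      EuclideanSpace ℝ (Fin N) => (P.1.1 - P.2, P.1.2))

lemma toReal_heatAvg {t : ℝ} (ht : 0 ≤ t) {f : EuclideanSpace ℝ (Fin N) → ℝ} (hf : Measurable f)
    (hf0 : ∀ y, 0 ≤ f y) (x : EuclideanSpace ℝ (Fin N)) :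
    (heatAvg t f x).toReal = ∫ y, heatKernel N (x - y) t * f y := by
  rw [integral_eq_lintegral_of_nonneg_ae, heatAvg]
  · exact Filter.Eventually.of_forall fun y => mul_nonneg (heatKernel_nonneg _ ht) (hf0 y)
  · refine Measurable.aestronglyMeasurable (Measurable.mul ?_ hf)
    exact measurable_heatKernel_uncurry.comp
      (by fun_prop : Measurable fun y : EuclideanSpace ℝ (Fin N) => (x - y, t))

/-- A supersolution of the Hardy parabolic equation yields a solution. -/
lemma exists_isSol_of_supersolution {γ p T : ℝ} (hp : 0 ≤ p)
    {u₀ : EuclideanSpace ℝ (Fin N) → ℝ} (hu : Measurable u₀) (hu0 : ∀ x, 0 ≤ u₀ x)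
    {w : EuclideanSpace ℝ (Fin N) → ℝ → ℝ} (hwm : Measurable (Function.uncurry w))
    (hw0 : ∀ x t, 0 < t → t < T → 0 ≤ w x t)
    (hw : ∀ x t, 0 < t → t < T → heatAvg t u₀ x +
      ∫⁻ s in Set.Ioo 0 t, heatAvg (t - s) (fun y => ‖y‖ ^ (-γ) * w y s ^ p) x ≤
        ENNReal.ofReal (w x t)) :
    ∃ u, IsSol N γ p T u₀ u := by
  classical
  let W : EuclideanSpace ℝ (Fin N) × ℝ → ℝ≥0∞ := fun q =>
    if q.2 ∈ Set.Ioo 0 T then ENNReal.ofReal (w q.1 q.2) else ⊤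
  have hWm : Measurable W := by
    refine Measurable.ite ?_ (ENNReal.measurable_ofReal.comp hwm) measurable_const
    exact measurableSet_Ioo.preimage measurable_snd
  have hW : ∀ q, heatAvg q.2 u₀ q.1 + ∫⁻ r, duhamelKernel γ q r * W r ^ p ≤ W q := by
    intro q
    by_cases hq : q.2 ∈ Set.Ioo 0 T
    · rw [lintegral_duhamelKernel_mul γ q (hWm.pow_const p)]
      have e : W q = ENNReal.ofReal (w q.1 q.2) := if_pos hq
      rw [e]
      refine le_trans (add_le_add_right (setLIntegral_mono' measurableSet_Ioo fun s hs => ?_) _)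
        (hw q.1 q.2 hq.1 hq.2)
      refine lintegral_mono fun y => ?_
      have hs' : s ∈ Set.Ioo 0 T := ⟨hs.1, hs.2.trans hq.2⟩
      have e' : W (y, s) = ENNReal.ofReal (w y s) := if_pos hs'
      have hk : 0 ≤ heatKernel N (q.1 - y) (q.2 - s) := heatKernel_nonneg _ (sub_pos.2 hs.2).le
      rw [e', ENNReal.ofReal_rpow_of_nonneg (hw0 _ _ hs'.1 hs'.2) hp,
        ← ENNReal.ofReal_mul (by positivity), mul_assoc]
    · have e : W q = ⊤ := if_neg hq
      rw [e]; exact le_top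
  obtain ⟨v, hvm, hvW, hv⟩ := exists_fixedPoint_le hp (measurable_heatAvg_uncurry hu)
    (measurable_duhamelKernel γ) hW
  have hvtop : ∀ q : EuclideanSpace ℝ (Fin N) × ℝ, q.2 ∈ Set.Ioo 0 T → v q ≠ ⊤ := fun q hq => by
    have e : W q = ENNReal.ofReal (w q.1 q.2) := if_pos hq
    exact ((hvW q).trans_lt (e ▸ ENNReal.ofReal_lt_top)).ne
  refine ⟨fun x t => (v (x, t)).toReal, hvm.ennreal_toReal, fun _ _ => ENNReal.toReal_nonneg,
    Filter.Eventually.of_forall fun q hq => ?_⟩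
  have hvq := hv q
  rw [lintegral_duhamelKernel_mul γ q (hvm.pow_const p)] at hvq
  have hfin : heatAvg q.2 u₀ q.1 ≠ ⊤ ∧ (∫⁻ s in Set.Ioo 0 q.2, ∫⁻ y,
      ENNReal.ofReal (heatKernel N (q.1 - y) (q.2 - s) * ‖y‖ ^ (-γ)) * v (y, s) ^ p) ≠ ⊤ := by
    rw [← ENNReal.add_ne_top, ← hvq]
    exact hvtop q hq
  have hJm := measurable_lintegral_slice γ q (hvm.pow_const p)
  have hq_eta : (v (q.1, q.2)).toReal = (v q).toReal := rfl
  beta_reduce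
  rw [hq_eta, hvq, ENNReal.toReal_add hfin.1 hfin.2, toReal_heatAvg hq.1.le hu hu0,
    ← integral_toReal hJm.aemeasurable (ae_lt_top hJm hfin.2)]
  congr 1
  refine setIntegral_congr_fun measurableSet_Ioo fun s hs => ?_
  have hk : ∀ y, 0 ≤ heatKernel N (q.1 - y) (q.2 - s) * ‖y‖ ^ (-γ) := fun y =>
    mul_nonneg (heatKernel_nonneg _ (sub_pos.2 hs.2).le) (by positivity)
  beta_reduce
  rw [integral_eq_lintegral_of_nonneg_ae]
  · congr 1
    refine lintegral_congr fun y => ?_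
    rw [ENNReal.ofReal_mul (hk y), ENNReal.toReal_rpow, ENNReal.ofReal_toReal]
    exact ENNReal.rpow_ne_top_of_nonneg hp (hvtop (y, s) ⟨hs.1, hs.2.trans hq.2⟩)
  · exact Filter.Eventually.of_forall fun y =>
      mul_nonneg (hk y) (Real.rpow_nonneg ENNReal.toReal_nonneg _)
  · refine Measurable.aestronglyMeasurable (Measurable.mul (Measurable.mul ?_ (by fun_prop))
      ((hvm.comp measurable_prodMk_right).ennreal_toReal.pow_const p))
    exact measurable_heatKernel_uncurry.comp
      (by fun_prop : Measurable fun y : EuclideanSpace ℝ (Fin N) => (q.1 - y, q.2 - s))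

lemma add_rpow_le_two_rpow_mul {x y p : ℝ} (hx : 0 ≤ x) (hy : 0 ≤ y) (hp : 0 ≤ p) :
    (x + y) ^ p ≤ 2 ^ p * (x ^ p + y ^ p) := by
  have hx' := Real.rpow_nonneg hx p
  have hy' := Real.rpow_nonneg hy p
  have h : ∀ m, x ≤ m → y ≤ m → (x + y) ^ p ≤ 2 ^ p * m ^ p := fun m hxm hym => by
    rw [← Real.mul_rpow zero_le_two (hx.trans hxm)]
    exact Real.rpow_le_rpow (by positivity) (by linarith) hp
  rcases le_total x y with hxy | hxy
  · refine (h y hxy le_rfl).trans ?_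
    gcongr
    linarith
  · refine (h x le_rfl hxy).trans ?_
    gcongr
    linarith

lemma measurable_heatAvg_weight (γ t : ℝ) (x : EuclideanSpace ℝ (Fin N)) :
    Measurable fun s : ℝ => heatAvg (t - s) (fun y => ‖y‖ ^ (-γ)) x := by
  simpa only [heatAvg, mul_one] using
    measurable_lintegral_slice γ (x, t) (V := fun _ => 1) measurable_const

lemma duhamel_supersolution_le {γ p a B D C₂ C₃ t : ℝ} {x z : EuclideanSpace ℝ (Fin N)}
    (hp : 0 ≤ p) (hap : a * p = a + 2) (hB : 0 ≤ B) (hD : 0 ≤ D) (hC₃ : 0 ≤ C₃) (ht : 0 < t)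
    (h₂ : ∫⁻ s in Set.Ioo 0 t, heatAvg (t - s) (fun y => ‖y‖ ^ (-γ)) x ≤
      ENNReal.ofReal (C₂ * t ^ (1 - γ / 2)))
    (h₃ : ∫⁻ s in Set.Ioo 0 t, heatAvg (t - s)
        (fun y => ‖y‖ ^ (-γ) * (‖y - z‖ ^ 2 + s) ^ (-(a + 2) / 2)) x ≤
      ENNReal.ofReal (C₃ * (‖z‖ ^ (-γ) * (‖x - z‖ ^ 2 + t) ^ (-a / 2)))) (hC₂ : 0 ≤ C₂) :
    ∫⁻ s in Set.Ioo 0 t, heatAvg (t - s)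
        (fun y => ‖y‖ ^ (-γ) * (B * (‖y - z‖ ^ 2 + s) ^ (-a / 2) + D) ^ p) x ≤
      ENNReal.ofReal (2 ^ p * D ^ p * (C₂ * t ^ (1 - γ / 2)) +
        2 ^ p * B ^ p * (C₃ * (‖z‖ ^ (-γ) * (‖x - z‖ ^ 2 + t) ^ (-a / 2)))) := by
  have h0D : 0 ≤ 2 ^ p * D ^ p := by positivity
  have h0B : 0 ≤ 2 ^ p * B ^ p := by positivity
  calc
    _ ≤ ∫⁻ s in Set.Ioo 0 t, (ENNReal.ofReal (2 ^ p * D ^ p) *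
          heatAvg (t - s) (fun y => ‖y‖ ^ (-γ)) x + ENNReal.ofReal (2 ^ p * B ^ p) *
          heatAvg (t - s) (fun y => ‖y‖ ^ (-γ) * (‖y - z‖ ^ 2 + s) ^ (-(a + 2) / 2)) x) := by
        refine setLIntegral_mono' measurableSet_Ioo fun s hs => ?_
        rw [← heatAvg_const_mul h0D, ← heatAvg_const_mul h0B]
        refine le_trans (heatAvg_mono_ae (sub_pos.2 hs.2).le
          (Filter.Eventually.of_forall fun y => ?_) x) (heatAvg_add_le (by fun_prop) x)
        have hs0 : 0 ≤ s := hs.1.le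
        have hq : 0 ≤ ‖y - z‖ ^ 2 + s := by positivity
        have e : (B * (‖y - z‖ ^ 2 + s) ^ (-a / 2)) ^ p =
            B ^ p * (‖y - z‖ ^ 2 + s) ^ (-(a + 2) / 2) := by
          rw [Real.mul_rpow hB (by positivity), ← Real.rpow_mul hq, ← hap]
          congr 2
          ring
        calc
          _ ≤ ‖y‖ ^ (-γ) * (2 ^ p * ((B * (‖y - z‖ ^ 2 + s) ^ (-a / 2)) ^ p + D ^ p)) := by
              gcongr
              exact add_rpow_le_two_rpow_mul (by positivity) hD hp
          _ = _ := by rw [e]; ring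
    _ = ENNReal.ofReal (2 ^ p * D ^ p) *
          (∫⁻ s in Set.Ioo 0 t, heatAvg (t - s) (fun y => ‖y‖ ^ (-γ)) x) +
        ENNReal.ofReal (2 ^ p * B ^ p) * ∫⁻ s in Set.Ioo 0 t,
          heatAvg (t - s) (fun y => ‖y‖ ^ (-γ) * (‖y - z‖ ^ 2 + s) ^ (-(a + 2) / 2)) x := by
        rw [lintegral_add_left ((measurable_heatAvg_weight γ t x).const_mul _),
          lintegral_const_mul' _ _ ENNReal.ofReal_ne_top,
          lintegral_const_mul' _ _ ENNReal.ofReal_ne_top]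
    _ ≤ _ := by
        rw [ENNReal.ofReal_add (by positivity) (by positivity), ENNReal.ofReal_mul h0D,
          ENNReal.ofReal_mul h0B]
        gcongr

lemma heatAvg_initial_le (hN : 1 ≤ N) {a A C₀ C₁ t : ℝ} {x z : EuclideanSpace ℝ (Fin N)}
    (ht : 0 < t) (hA : 0 ≤ A) (hC₀ : 0 ≤ C₀) (hC₁ : 0 ≤ C₁)
    {u₀ : EuclideanSpace ℝ (Fin N) → ℝ}
    (hu : ∀ y, y ≠ z → u₀ y ≤ A * ‖y - z‖ ^ (-a) + C₀)
    (h₁ : heatAvg t (fun y => (‖y - z‖ ^ 2 + 0) ^ (-a / 2)) x ≤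
      ENNReal.ofReal (C₁ * (‖x - z‖ ^ 2 + 0 + t) ^ (-a / 2))) :
    heatAvg t u₀ x ≤ ENNReal.ofReal (A * (C₁ * (‖x - z‖ ^ 2 + t) ^ (-a / 2)) + C₀) := by
  rw [add_zero] at h₁
  calc
    _ ≤ heatAvg t (fun y => A * (‖y - z‖ ^ 2 + 0) ^ (-a / 2) + C₀) x := by
        refine heatAvg_mono_ne hN ht.le z (fun y hy => (hu y hy).trans_eq ?_) x
        rw [add_zero, ← Real.rpow_natCast, ← Real.rpow_mul (norm_nonneg _)]
        congr 3
        push_cast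
        ring
    _ ≤ _ := heatAvg_add_le (by fun_prop) x
    _ ≤ _ := by
        rw [heatAvg_const_mul hA, heatAvg_const hC₀ ht,
          ENNReal.ofReal_add (by positivity) hC₀, ENNReal.ofReal_mul hA]
        gcongr

end Existence

theorem statement0 (N : ℕ) (hN : 1 ≤ N) (γ p : ℝ)
    (hγ0 : 0 < γ) (hγ : γ < min 2 (N : ℝ)) (hp : 1 + 2 / (N : ℝ) < p) :
    ∃ cstar Cstar : ℝ, 0 < cstar ∧ 0 < Cstar ∧
      ∀ (T : ℝ), 0 < T →
      ∀ (z : EuclideanSpace ℝ (Fin N)), z ≠ 0 →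
      ∀ (u₀ : EuclideanSpace ℝ (Fin N) → ℝ) (c C₀ : ℝ),
        Measurable u₀ → (∀ x, 0 ≤ u₀ x) →
        0 < c → c ≤ cstar →
        0 ≤ C₀ → C₀ ≤ Cstar * T ^ (-(2 - γ) / (2 * (p - 1))) →
        (∀ x, x ≠ z →
          u₀ x ≤ c * ‖z‖ ^ (γ / (p - 1)) * ‖x - z‖ ^ (-2 / (p - 1)) + C₀) →
        ∃ u, IsSol N γ p T u₀ u := by
  obtain ⟨hγ2, hγN⟩ := lt_min_iff.1 hγ
  have hN0 : (0 : ℝ) < N := by exact_mod_cast hN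
  have hp1 : 0 < p - 1 := by
    have : 0 < 2 / (N : ℝ) := by positivity
    linarith
  have hp0 : 0 < p := by linarith
  set a : ℝ := 2 / (p - 1) with ha
  have ha0 : 0 < a := by positivity
  have haN : a < N := by
    rw [ha, div_lt_iff₀ hp1]
    have : 2 / (N : ℝ) < p - 1 := by linarith
    rwa [div_lt_iff₀ hN0, mul_comm] at this
  have hap : a * p = a + 2 := by
    rw [ha]
    field_simp
    ring
  obtain ⟨C₁, hC₁, h₁⟩ := exists_heatAvg_profile_le hN ha0.le haN
  obtain ⟨C₂, hC₂, h₂⟩ := exists_duhamel_const_le hN hγ0.le hγ2 hγN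
  obtain ⟨C₃, hC₃, h₃⟩ := exists_duhamel_profile_le hN hγ0 hγ2 hγN ha0 haN
  have hX : 0 < C₁ / (2 ^ p * (2 * C₁) ^ p * C₃) := by positivity
  have hY : 0 < 1 / (2 ^ p * 2 ^ p * C₂) := by positivity
  refine ⟨(C₁ / (2 ^ p * (2 * C₁) ^ p * C₃)) ^ (1 / (p - 1)),
    (1 / (2 ^ p * 2 ^ p * C₂)) ^ (1 / (p - 1)), by positivity, by positivity, ?_⟩
  intro T hT z hz u₀ c C₀ hum hu0 hc hcs hC₀ hC₀s hu
  have hzn : 0 < ‖z‖ := norm_pos_iff.2 hz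
  set A : ℝ := c * ‖z‖ ^ (γ / (p - 1)) with hA
  have hA0 : 0 < A := by positivity
  have hpow : ∀ {b : ℝ}, 0 ≤ b → b ^ p = b * b ^ (p - 1) := fun {b} hb => by
    conv_lhs => rw [show p = 1 + (p - 1) by ring]
    rw [Real.rpow_add_of_nonneg hb zero_le_one hp1.le, Real.rpow_one]
  have hroot : ∀ {b : ℝ}, 0 ≤ b → (b ^ (1 / (p - 1))) ^ (p - 1) = b := fun {b} hb => by
    rw [← Real.rpow_mul hb, one_div_mul_cancel hp1.ne', Real.rpow_one]
  have hcp : c ^ (p - 1) ≤ C₁ / (2 ^ p * (2 * C₁) ^ p * C₃) := by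
    rw [← hroot hX.le]
    exact Real.rpow_le_rpow hc.le hcs hp1.le
  have hAp : A ^ (p - 1) * ‖z‖ ^ (-γ) = c ^ (p - 1) := by
    rw [hA, Real.mul_rpow hc.le (by positivity), ← Real.rpow_mul hzn.le,
      div_mul_cancel₀ _ hp1.ne', mul_assoc, ← Real.rpow_add hzn, add_neg_cancel, Real.rpow_zero,
      mul_one]
  have hCp : C₀ ^ (p - 1) ≤ 1 / (2 ^ p * 2 ^ p * C₂) * T ^ (-(1 - γ / 2)) := by
    refine (Real.rpow_le_rpow hC₀ hC₀s hp1.le).trans_eq ?_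
    rw [Real.mul_rpow (by positivity) (by positivity), hroot hY.le, ← Real.rpow_mul hT.le]
    congr 2
    field_simp
  have hnl₁ : 2 ^ p * (2 * C₁ * A) ^ p * C₃ * ‖z‖ ^ (-γ) ≤ C₁ * A := by
    rw [le_div_iff₀ (by positivity), ← hAp] at hcp
    calc
      _ = A * (A ^ (p - 1) * ‖z‖ ^ (-γ) * (2 ^ p * (2 * C₁) ^ p * C₃)) := by
          rw [Real.mul_rpow (by positivity) hA0.le, hpow hA0.le]
          ring
      _ ≤ A * C₁ := by gcongr
      _ = _ := mul_comm _ _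
  have hnl₂ : ∀ t, 0 < t → t < T → 2 ^ p * (2 * C₀) ^ p * (C₂ * t ^ (1 - γ / 2)) ≤ C₀ := by
    intro t ht htT
    have hTt : t ^ (1 - γ / 2) ≤ T ^ (1 - γ / 2) :=
      Real.rpow_le_rpow ht.le htT.le (by linarith)
    calc
      _ ≤ 2 ^ p * (2 * C₀) ^ p * (C₂ * T ^ (1 - γ / 2)) := by gcongr
      _ = C₀ * (2 ^ p * 2 ^ p * C₂ * T ^ (1 - γ / 2) * C₀ ^ (p - 1)) := by
          rw [Real.mul_rpow zero_le_two hC₀, hpow hC₀]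
          ring
      _ ≤ C₀ * (2 ^ p * 2 ^ p * C₂ * T ^ (1 - γ / 2) *
            (1 / (2 ^ p * 2 ^ p * C₂) * T ^ (-(1 - γ / 2)))) := by gcongr
      _ = C₀ := by
          rw [Real.rpow_neg hT.le]
          have := (Real.rpow_pos_of_pos hT (1 - γ / 2)).ne'
          field_simp
  refine exists_isSol_of_supersolution hp0.le hum hu0
    (w := fun x t => 2 * C₁ * A * (‖x - z‖ ^ 2 + t) ^ (-a / 2) + 2 * C₀)
    (by unfold Function.uncurry; fun_prop) (fun x t ht _ => by positivity) fun x t ht htT => ?_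
  have hφ : 0 ≤ (‖x - z‖ ^ 2 + t) ^ (-a / 2) := by positivity
  refine (add_le_add (heatAvg_initial_le (a := a) hN ht hA0.le hC₀ hC₁.le ?_ (h₁ x z t 0 ht le_rfl))
    (duhamel_supersolution_le hp0.le hap (B := 2 * C₁ * A) (by positivity) (D := 2 * C₀)
      (by positivity) hC₃.le ht (h₂ x t ht) (h₃ x z t hz ht) hC₂.le)).trans ?_
  · intro y hy
    have := hu y hy
    rwa [neg_div] at this
  · rw [← ENNReal.ofReal_add (by positivity) (by positivity)]
    refine ENNReal.ofReal_le_ofReal ?_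
    have e₁ := mul_le_mul_of_nonneg_right hnl₁ hφ
    have e₂ := hnl₂ t ht htT
    linarith
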